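/- arXiv:2402.15315 — 7 statements merged into one kernel-verified Lean document; each statement's English description precedes it below -/
import Mathlib

section
/- Let f₁, f₂, f₃ : ℝⁿ → ℝ be CPWL functions with minimal depths m₁, m₂, m₃ respectively, and suppose f₁ + f₂ = f₃. Then there exist distinct indices i₁ ≠ i₂ in {1,2,3} such that m_{i₁} = m_{i₂}, and the remaining index i₃ satisfies m_{i₃} ≤ m_{i₁}. -/
open Pointwise

noncomputable section

/-- `NN m n` is the set of functions `ℝⁿ → ℝ` representable by a ReLU neural network
with `m` hidden layers: `f = T⁽ᵐ⁺¹⁾ ∘ σ ∘ T⁽ᵐ⁾ ∘ σ ∘ ⋯ ∘ σ ∘ T⁽¹⁾` with each `T⁽ˡ⁾` affine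
and `σ` the componentwise ReLU.  (`NN 0 n` is the set of affine functions.) -/
def NN : ℕ → (n : ℕ) → Set ((Fin n → ℝ) → ℝ)
  | 0, n => {f | ∃ T : (Fin n → ℝ) →ᵃ[ℝ] ℝ, f = ⇑T}
  | m + 1, n => {f | ∃ (w : ℕ) (T : (Fin n → ℝ) →ᵃ[ℝ] (Fin w → ℝ)),
      ∃ g ∈ NN m w, f = fun x => g fun i => max (T x i) 0}

/-- Continuous piecewise linear functions `ℝⁿ → ℝ`: continuous functions that at each point
agree with one of finitely many affine functions. -/
def CPWL (n : ℕ) : Set ((Fin n → ℝ) → ℝ) :=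
  {f | Continuous f ∧ ∃ s : Finset ((Fin n → ℝ) →ᵃ[ℝ] ℝ), ∀ x, ∃ g ∈ s, f x = g x}

/-- `f` has minimal depth `m`: `f ∈ Υₙ(m)` and either `m = 0` or `f ∉ Υₙ(m-1)`. -/
def MinDepth (n : ℕ) (f : (Fin n → ℝ) → ℝ) (m : ℕ) : Prop :=
  f ∈ NN m n ∧ (m = 0 ∨ f ∉ NN (m - 1) n)

/-- `Mn n` is the least `m` such that `Υₙ = Υₙ(m)`. -/
def Mn (n : ℕ) : ℕ := sInf {m | CPWL n = NN m n}
/-- Linear combinations of networks of equal depth, precomposed with affine maps, are networks of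
the same depth. -/
theorem NN_linearCombination_comp_mem (a b : ℝ) (m : ℕ) {n k p : ℕ} {f : (Fin n → ℝ) → ℝ}
    {g : (Fin k → ℝ) → ℝ} (hf : f ∈ NN m n) (hg : g ∈ NN m k)
    (A : (Fin p → ℝ) →ᵃ[ℝ] (Fin n → ℝ)) (B : (Fin p → ℝ) →ᵃ[ℝ] (Fin k → ℝ)) :
    (fun x => a * f (A x) + b * g (B x)) ∈ NN m p := by
  induction m generalizing n k p with
  | zero =>
    obtain ⟨T, rfl⟩ := hf
    obtain ⟨S, rfl⟩ := hg
    exact ⟨a • T.comp A + b • S.comp B, by ext x; simp⟩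
  | succ m ih =>
    obtain ⟨v, T, f, hf, rfl⟩ := hf
    obtain ⟨w, S, g, hg, rfl⟩ := hg
    refine ⟨v + w, AffineMap.pi (Fin.addCases
        (fun i => (AffineMap.proj (k := ℝ) (P := fun _ : Fin v => ℝ) i).comp (T.comp A))
        (fun i => (AffineMap.proj (k := ℝ) (P := fun _ : Fin w => ℝ) i).comp (S.comp B))), _,
      ih hf hg (LinearMap.funLeft ℝ ℝ (Fin.castAdd w)).toAffineMap
        (LinearMap.funLeft ℝ ℝ (Fin.natAdd v)).toAffineMap, ?_⟩
    ext x
    simp [LinearMap.funLeft, Function.comp_def]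

theorem NN_add_mem {m n : ℕ} {f g : (Fin n → ℝ) → ℝ} (hf : f ∈ NN m n) (hg : g ∈ NN m n) :
    f + g ∈ NN m n := by
  simpa [Pi.add_def] using NN_linearCombination_comp_mem 1 1 m hf hg (.id ℝ _) (.id ℝ _)

theorem NN_sub_mem {m n : ℕ} {f g : (Fin n → ℝ) → ℝ} (hf : f ∈ NN m n) (hg : g ∈ NN m n) :
    f - g ∈ NN m n := by
  simpa [Pi.sub_def, ← sub_eq_add_neg] using
    NN_linearCombination_comp_mem 1 (-1) m hf hg (.id ℝ _) (.id ℝ _)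

theorem NN_subset_succ (m n : ℕ) : NN m n ⊆ NN (m + 1) n := by
  induction m generalizing n with
  | zero =>
    rintro _ ⟨T, rfl⟩
    refine ⟨2, AffineMap.pi ![T, -T], _, ⟨(LinearMap.proj (R := ℝ) (φ := fun _ : Fin 2 => ℝ) 0 -
      LinearMap.proj (R := ℝ) (φ := fun _ : Fin 2 => ℝ) 1).toAffineMap, rfl⟩, ?_⟩
    ext x
    simpa [max_comm] using (max_zero_sub_eq_self (T x)).symm
  | succ m ih =>
    rintro _ ⟨w, T, g, hg, rfl⟩
    exact ⟨w, T, g, ih w hg, rfl⟩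

theorem NN_mono (n : ℕ) : Monotone fun m => NN m n :=
  monotone_nat_of_le_succ fun m => NN_subset_succ m n

theorem MinDepth.le_of_mem {n m k : ℕ} {f : (Fin n → ℝ) → ℝ} (h : MinDepth n f m)
    (hf : f ∈ NN k n) : m ≤ k := by
  by_contra! hk
  rcases h.2 with h0 | h0
  · omega
  · exact h0 (NN_mono n (by omega : k ≤ m - 1) hf)

theorem MinDepth.mem_of_le {n m k : ℕ} {f : (Fin n → ℝ) → ℝ} (h : MinDepth n f m)
    (hmk : m ≤ k) : f ∈ NN k n :=
  NN_mono n hmk h.1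

/-- If `f₁, f₂, f₃` are CPWL with minimal depths `m₁, m₂, m₃` and `f₁ + f₂ = f₃`,
then two of the depths are equal and the remaining one is at most them. -/
theorem statement1 (n m₁ m₂ m₃ : ℕ) (f₁ f₂ f₃ : (Fin n → ℝ) → ℝ)
    (h₁ : f₁ ∈ CPWL n) (h₂ : f₂ ∈ CPWL n) (h₃ : f₃ ∈ CPWL n)
    (hm₁ : MinDepth n f₁ m₁) (hm₂ : MinDepth n f₂ m₂) (hm₃ : MinDepth n f₃ m₃)
    (hsum : f₁ + f₂ = f₃) :
    (m₁ = m₂ ∧ m₃ ≤ m₁) ∨ (m₁ = m₃ ∧ m₂ ≤ m₁) ∨ (m₂ = m₃ ∧ m₁ ≤ m₂) := by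
  have le₃ : m₃ ≤ max m₁ m₂ := hm₃.le_of_mem <| hsum ▸
    NN_add_mem (hm₁.mem_of_le (le_max_left _ _)) (hm₂.mem_of_le (le_max_right _ _))
  have le₂ : m₂ ≤ max m₃ m₁ := hm₂.le_of_mem <| (sub_eq_of_eq_add' hsum.symm : f₃ - f₁ = f₂) ▸
    NN_sub_mem (hm₃.mem_of_le (le_max_left _ _)) (hm₁.mem_of_le (le_max_right _ _))
  have le₁ : m₁ ≤ max m₃ m₂ := hm₁.le_of_mem <| (sub_eq_of_eq_add hsum.symm : f₃ - f₂ = f₁) ▸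
    NN_sub_mem (hm₃.mem_of_le (le_max_left _ _)) (hm₂.mem_of_le (le_max_right _ _))
  omega
end
end

section
/- For every m with 1 ≤ m ≤ M_n, there exists a CPWL function g : ℝⁿ → ℝ with minimal depth m − 1 such that the function max(g, 0) (pointwise maximum with the zero function) has minimal depth m. -/
open Pointwise

noncomputable section

namespace NN

/-- Representable functions are closed under affine changes of the input. -/
lemma comp_affine {m n w : ℕ} {f : (Fin w → ℝ) → ℝ} (hf : f ∈ NN m w)
    (A : (Fin n → ℝ) →ᵃ[ℝ] (Fin w → ℝ)) : (fun x => f (A x)) ∈ NN m n := by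
  cases m with
  | zero =>
    obtain ⟨T, rfl⟩ := hf
    exact ⟨T.comp A, rfl⟩
  | succ m =>
    obtain ⟨v, T, g, hg, rfl⟩ := hf
    exact ⟨v, T.comp A, g, hg, rfl⟩

/-- Taking the positive part costs one hidden layer. -/
lemma max_zero_mem_succ {m n : ℕ} {f : (Fin n → ℝ) → ℝ} (hf : f ∈ NN m n) :
    (fun x => max (f x) 0) ∈ NN (m + 1) n := by
  induction m generalizing n with
  | zero =>
    obtain ⟨T, rfl⟩ := hf
    exact ⟨1, AffineMap.pi fun _ => T, fun y => y 0,
      ⟨(LinearMap.proj (R := ℝ) (φ := fun _ : Fin 1 => ℝ) 0).toAffineMap, rfl⟩, rfl⟩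
  | succ m ih =>
    obtain ⟨w, T, g, hg, rfl⟩ := hf
    exact ⟨w, T, _, ih hg, rfl⟩

lemma smul_mem {m n : ℕ} {f : (Fin n → ℝ) → ℝ} (c : ℝ) (hf : f ∈ NN m n) :
    c • f ∈ NN m n := by
  induction m generalizing n with
  | zero =>
    obtain ⟨T, rfl⟩ := hf
    exact ⟨c • T, rfl⟩
  | succ m ih =>
    obtain ⟨w, T, g, hg, rfl⟩ := hf
    exact ⟨w, T, _, ih hg, rfl⟩

lemma add_mem {m n : ℕ} {f g : (Fin n → ℝ) → ℝ} (hf : f ∈ NN m n) (hg : g ∈ NN m n) :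
    f + g ∈ NN m n := by
  induction m generalizing n with
  | zero =>
    obtain ⟨T, rfl⟩ := hf
    obtain ⟨U, rfl⟩ := hg
    exact ⟨T + U, rfl⟩
  | succ m ih =>
    obtain ⟨v, T, f, hf, rfl⟩ := hf
    obtain ⟨w, U, g, hg, rfl⟩ := hg
    refine ⟨v + w, AffineMap.pi (Fin.append
      (fun i => (LinearMap.proj (R := ℝ) (φ := fun _ : Fin v => ℝ) i).toAffineMap.comp T)
      (fun i => (LinearMap.proj (R := ℝ) (φ := fun _ : Fin w => ℝ) i).toAffineMap.comp U)), _,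
      ih (comp_affine hf (LinearMap.funLeft ℝ ℝ (Fin.castAdd w)).toAffineMap)
        (comp_affine hg (LinearMap.funLeft ℝ ℝ (Fin.natAdd v)).toAffineMap), ?_⟩
    ext x
    simp [Function.comp_def, LinearMap.funLeft]

lemma subset_succ (m n : ℕ) : NN m n ⊆ NN (m + 1) n := by
  intro f hf
  convert add_mem (max_zero_mem_succ hf)
    (smul_mem (-1) (max_zero_mem_succ (smul_mem (-1) hf))) using 1
  ext x
  rcases le_total (f x) 0 with h | h <;> simp [h]

lemma monotone (n : ℕ) : Monotone fun m => NN m n :=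
  monotone_nat_of_le_succ fun m => subset_succ m n

/-- Functions representable with `m` hidden layers, as a linear subspace. -/
def submodule (m n : ℕ) : Submodule ℝ ((Fin n → ℝ) → ℝ) where
  carrier := NN m n
  add_mem' := add_mem
  zero_mem' := monotone n m.zero_le ⟨0, rfl⟩
  smul_mem' c _ := smul_mem c

/-- A linear space of functions that contains the constants and is closed under positive parts
is closed under composition with networks of any depth. -/
lemma comp_mem_of_max_zero_mem {X : Type*} {S : Submodule ℝ (X → ℝ)}
    (hconst : ∀ c : ℝ, (fun _ => c) ∈ S) (hmax : ∀ g ∈ S, (fun x => max (g x) 0) ∈ S)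
    {k w : ℕ} {f : (Fin w → ℝ) → ℝ} (hf : f ∈ NN k w) {G : X → Fin w → ℝ}
    (hG : ∀ i, (fun x => G x i) ∈ S) : (fun x => f (G x)) ∈ S := by
  have haffine : ∀ {w : ℕ} (T : (Fin w → ℝ) →ᵃ[ℝ] ℝ) {G : X → Fin w → ℝ},
      (∀ i, (fun x => G x i) ∈ S) → (fun x => T (G x)) ∈ S := by
    intro w T G hG
    convert S.add_mem (S.sum_mem fun i (_ : i ∈ Finset.univ) =>
      S.smul_mem (T.linear (Pi.single i 1)) (hG i)) (hconst (T 0)) using 1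
    ext x
    have hsingle (i : Fin w) : (fun j => if i = j then (1 : ℝ) else 0) = Pi.single i 1 := by
      ext j
      simp [Pi.single_apply, eq_comm]
    have h := congrFun T.decomp (G x)
    rw [Pi.add_apply, LinearMap.pi_apply_eq_sum_univ] at h
    simp [h, hsingle, mul_comm]
  induction k generalizing w with
  | zero =>
    obtain ⟨T, rfl⟩ := hf
    exact haffine T hG
  | succ k ih =>
    obtain ⟨v, T, g, hg, rfl⟩ := hf
    exact ih hg fun i => hmax _ <| haffine
      ((LinearMap.proj (R := ℝ) (φ := fun _ : Fin v => ℝ) i).toAffineMap.comp T) hG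

/-- If positive parts cost no layer at depth `m`, then no depth exceeds depth `m`. -/
lemma subset_of_max_zero_mem {m n : ℕ}
    (hmax : ∀ g ∈ NN m n, (fun x => max (g x) 0) ∈ NN m n) (k : ℕ) : NN k n ⊆ NN m n :=
  fun _ hf => comp_mem_of_max_zero_mem (S := submodule m n)
    (fun c => monotone n m.zero_le ⟨AffineMap.const ℝ _ c, rfl⟩) hmax hf
    fun i => monotone n m.zero_le
      ⟨(LinearMap.proj (R := ℝ) (φ := fun _ : Fin n => ℝ) i).toAffineMap, rfl⟩

end NN

lemma CPWL_eq_NN_Mn {n : ℕ} (h : 0 < Mn n) : CPWL n = NN (Mn n) n :=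
  Nat.sInf_mem (Nat.nonempty_of_pos_sInf h)

/-- For every `1 ≤ m ≤ Mₙ` there is a CPWL function `g` with minimal depth
`m - 1` such that `max (g, 0)` has minimal depth `m`. -/
theorem statement7 (n m : ℕ) (h1 : 1 ≤ m) (h2 : m ≤ Mn n) :
    ∃ g : (Fin n → ℝ) → ℝ, g ∈ CPWL n ∧ MinDepth n g (m - 1) ∧
      MinDepth n (fun x => max (g x) 0) m := by
  obtain ⟨m, rfl⟩ := Nat.exists_eq_add_of_le' h1
  have hC := CPWL_eq_NN_Mn (h1.trans h2)
  have hle : NN m n ⊆ NN (Mn n) n := NN.monotone n (Nat.le_of_succ_le h2)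
  obtain ⟨g, hg, hgmax⟩ : ∃ g ∈ NN m n, (fun x => max (g x) 0) ∉ NN m n := by
    by_contra! hmax
    exact Nat.notMem_of_lt_sInf (Nat.lt_of_succ_le h2)
      (hC.trans ((NN.subset_of_max_zero_mem hmax _).antisymm hle))
  refine ⟨g, hC ▸ hle hg, ⟨hg, ?_⟩, NN.max_zero_mem_succ hg, Or.inr hgmax⟩
  cases m with
  | zero => exact Or.inl rfl
  | succ m => exact Or.inr fun h => hgmax (NN.max_zero_mem_succ h)
end
end

section
/- Let m₁, m₂ ∈ ℕ with m₁ ≤ m₂ ≤ M_n, and let m* be a natural number such that either (i) m₁ = m₂ and m* ≤ min(m₂ + 1, M_n), or (ii) m₁ ≠ m₂ and m* ∈ {m₁, m₂, min(m₂ + 1, M_n)}. Then there exist CPWL functions f₁, f₂ : ℝⁿ → ℝ with minimal depths m₁ and m₂ respectively such that max(f₁, f₂) (pointwise maximum) has minimal depth m*. -/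
open Pointwise

noncomputable section

/-- Networks are stable under affine changes of the input. -/
theorem NN_comp_affine {m n k : ℕ} {f : (Fin n → ℝ) → ℝ} (hf : f ∈ NN m n)
    (A : (Fin k → ℝ) →ᵃ[ℝ] (Fin n → ℝ)) : (fun x => f (A x)) ∈ NN m k := by
  cases m with
  | zero =>
    obtain ⟨T, rfl⟩ := hf
    exact ⟨T.comp A, rfl⟩
  | succ m =>
    obtain ⟨w, T, g, hg, rfl⟩ := hf
    exact ⟨w, T.comp A, g, hg, rfl⟩

theorem NN_smul {m n : ℕ} (c : ℝ) {f : (Fin n → ℝ) → ℝ} (hf : f ∈ NN m n) :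
    c • f ∈ NN m n := by
  induction m generalizing n with
  | zero =>
    obtain ⟨T, rfl⟩ := hf
    exact ⟨c • T, rfl⟩
  | succ m ih =>
    obtain ⟨w, T, g, hg, rfl⟩ := hf
    exact ⟨w, T, c • g, ih hg, rfl⟩

theorem NN_add {m n : ℕ} {f f' : (Fin n → ℝ) → ℝ} (hf : f ∈ NN m n) (hf' : f' ∈ NN m n) :
    f + f' ∈ NN m n := by
  induction m generalizing n with
  | zero =>
    obtain ⟨T, rfl⟩ := hf
    obtain ⟨T', rfl⟩ := hf'
    exact ⟨T + T', rfl⟩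
  | succ m ih =>
    obtain ⟨w, T, g, hg, rfl⟩ := hf
    obtain ⟨w', T', g', hg', rfl⟩ := hf'
    let stacked : (Fin n → ℝ) →ᵃ[ℝ] (Fin (w + w') → ℝ) :=
      AffineMap.pi fun i => Fin.addCases
        (fun j => (LinearMap.proj j : (Fin w → ℝ) →ₗ[ℝ] ℝ).toAffineMap.comp T)
        (fun j => (LinearMap.proj j : (Fin w' → ℝ) →ₗ[ℝ] ℝ).toAffineMap.comp T') i
    refine ⟨w + w', stacked, _,
      ih (NN_comp_affine hg (LinearMap.funLeft ℝ ℝ (Fin.castAdd w')).toAffineMap)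
        (NN_comp_affine hg' (LinearMap.funLeft ℝ ℝ (Fin.natAdd w)).toAffineMap), ?_⟩
    funext x
    simp [stacked, LinearMap.funLeft, Function.comp_def]

theorem NN_zero_mem (m n : ℕ) : (0 : (Fin n → ℝ) → ℝ) ∈ NN m n := by
  induction m generalizing n with
  | zero => exact ⟨0, rfl⟩
  | succ m ih => exact ⟨0, 0, 0, ih 0, rfl⟩

/-- The functions representable with `m` hidden layers form a linear subspace. -/
def NNSubmodule (m n : ℕ) : Submodule ℝ ((Fin n → ℝ) → ℝ) where
  carrier := NN m n
  add_mem' := NN_add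
  zero_mem' := NN_zero_mem m n
  smul_mem' c _ := NN_smul c

theorem mem_NNSubmodule {m n : ℕ} {f : (Fin n → ℝ) → ℝ} :
    f ∈ NNSubmodule m n ↔ f ∈ NN m n := Iff.rfl

theorem NN_relu {m n : ℕ} {f : (Fin n → ℝ) → ℝ} (hf : f ∈ NN m n) :
    (fun x => max (f x) 0) ∈ NN (m + 1) n := by
  induction m generalizing n with
  | zero =>
    obtain ⟨T, rfl⟩ := hf
    exact ⟨1, AffineMap.pi fun _ => T, fun y => y 0,
      ⟨(LinearMap.proj 0 : (Fin 1 → ℝ) →ₗ[ℝ] ℝ).toAffineMap, rfl⟩, rfl⟩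
  | succ m ih =>
    obtain ⟨w, T, g, hg, rfl⟩ := hf
    exact ⟨w, T, _, ih hg, rfl⟩

theorem NN_mono_s8 {m k : ℕ} (n : ℕ) (h : m ≤ k) : NN m n ⊆ NN k n :=
  monotone_nat_of_le_succ (f := fun m => NN m n) (fun m => NN_subset_succ m n) h

/-- `NN (m + 1) n` is spanned by the rectifications of the elements of `NN m n`. -/
theorem NN_succ_subset_of_relu_mem {m n : ℕ} (S : Submodule ℝ ((Fin n → ℝ) → ℝ))
    (hS : ∀ g ∈ NN m n, (fun x => max (g x) 0) ∈ S) : NN (m + 1) n ⊆ S := by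
  induction m generalizing n with
  | zero =>
    rintro _ ⟨w, T, _, ⟨A, rfl⟩, rfl⟩
    have hconst : ∀ c : ℝ, (fun _ => c) ∈ S := by
      intro c
      have h := S.smul_mem c (hS (fun _ => 1) ⟨AffineMap.const ℝ _ 1, rfl⟩)
      convert h using 1
      funext x
      simp
    have hsum : (∑ i, A.linear (Pi.single i 1) • fun x => max (T x i) 0) ∈ S :=
      S.sum_mem fun i _ => S.smul_mem _ <| hS _
        ⟨(LinearMap.proj i : (Fin w → ℝ) →ₗ[ℝ] ℝ).toAffineMap.comp T, rfl⟩
    rw [SetLike.mem_coe]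
    convert S.add_mem hsum (hconst (A 0)) using 1
    funext x
    have hA := congrFun A.decomp fun i => max (T x i) 0
    rw [hA, Pi.add_apply, Pi.add_apply, LinearMap.pi_apply_eq_sum_univ]
    simp only [Finset.sum_apply, Pi.smul_apply, smul_eq_mul, mul_comm]
    congr! 5 with i
    simp [Pi.single_apply, eq_comm]
  | succ m ih =>
    rintro _ ⟨w, T, g, hg, rfl⟩
    exact ih (S.comap (LinearMap.funLeft ℝ ℝ fun x i => max (T x i) 0))
      (fun h hh => hS _ ⟨w, T, h, hh, rfl⟩) hg

/-- If `NN m n` is closed under rectification, then depth beyond `m` does not help. -/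
theorem NN_eq_of_relu_mem {m k n : ℕ} (h : ∀ g ∈ NN m n, (fun x => max (g x) 0) ∈ NN m n)
    (hk : m ≤ k) : NN k n = NN m n := by
  induction k, hk using Nat.le_induction with
  | base => rfl
  | succ k hk ih =>
    refine (NN_succ_subset_of_relu_mem (NNSubmodule m n) ?_).antisymm (NN_mono_s8 n (by omega))
    rw [ih]
    exact h

theorem exists_relu_notMem_NN {m n : ℕ} (h : m < Mn n) :
    ∃ g ∈ NN m n, (fun x => max (g x) 0) ∉ NN m n := by
  by_contra! hcon
  have hM : CPWL n = NN (Mn n) n :=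
    Nat.sInf_mem (Nat.nonempty_of_pos_sInf (m.zero_le.trans_lt h))
  exact Nat.notMem_of_lt_sInf h (hM.trans (NN_eq_of_relu_mem hcon h.le))

theorem minDepth_succ {m n : ℕ} {f : (Fin n → ℝ) → ℝ} :
    MinDepth n f (m + 1) ↔ f ∈ NN (m + 1) n ∧ f ∉ NN m n := by
  simp [MinDepth]

theorem minDepth_relu {m n : ℕ} {g : (Fin n → ℝ) → ℝ} (hg : g ∈ NN m n)
    (hrelu : (fun x => max (g x) 0) ∉ NN m n) : MinDepth n (fun x => max (g x) 0) (m + 1) :=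
  minDepth_succ.2 ⟨NN_relu hg, hrelu⟩

theorem exists_minDepth {m n : ℕ} (h : m ≤ Mn n) : ∃ f, MinDepth n f m := by
  cases m with
  | zero => exact ⟨0, NN_zero_mem 0 n, Or.inl rfl⟩
  | succ m =>
    obtain ⟨g, hg, hrelu⟩ := exists_relu_notMem_NN h
    exact ⟨_, minDepth_relu hg hrelu⟩

/-- Adding a strictly shallower function preserves the minimal depth. -/
theorem MinDepth.add_of_lt {m k n : ℕ} {f h : (Fin n → ℝ) → ℝ} (hf : MinDepth n f m)
    (hh : h ∈ NN k n) (hkm : k < m) : MinDepth n (h + f) m := by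
  obtain ⟨m, rfl⟩ := Nat.exists_eq_add_of_lt hkm
  rw [minDepth_succ] at hf ⊢
  refine ⟨NN_add (NN_mono_s8 n hkm.le hh) hf.1, fun hmem => hf.2 ?_⟩
  exact ((NNSubmodule (k + m) n).add_mem_iff_right (NN_mono_s8 n (by omega) hh)).1 hmem

theorem MinDepth.smul {m n : ℕ} {f : (Fin n → ℝ) → ℝ} (hf : MinDepth n f m) {c : ℝ}
    (hc : c ≠ 0) : MinDepth n (c • f) m :=
  ⟨NN_smul c hf.1, hf.2.imp_right fun h hmem =>
    h (((NNSubmodule (m - 1) n).smul_mem_iff hc).1 hmem)⟩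

theorem exists_minDepth_max_succ {n m₁ m₂ : ℕ} (h12 : m₁ ≤ m₂) (h2 : m₂ < Mn n) :
    ∃ f₁ f₂ : (Fin n → ℝ) → ℝ, MinDepth n f₁ m₁ ∧ MinDepth n f₂ m₂ ∧
      MinDepth n (fun x => max (f₁ x) (f₂ x)) (m₂ + 1) := by
  obtain ⟨g, hg, hrelu⟩ := exists_relu_notMem_NN h2
  have hgdepth : MinDepth n g m₂ := by
    refine ⟨hg, ?_⟩
    cases m₂ with
    | zero => exact Or.inl rfl
    | succ m => exact Or.inr fun hmem => hrelu (NN_relu hmem)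
  have key : ∀ h ∈ NN m₂ n,
      MinDepth n (fun x => max (h x) ((h + g) x)) (m₂ + 1) := by
    intro h hh
    convert (minDepth_relu hg hrelu).add_of_lt hh (Nat.lt_succ_self m₂) using 1
    funext x
    simp only [Pi.add_apply]
    rw [← max_add_add_left, add_zero, max_comm]
  rcases h12.eq_or_lt with rfl | hlt
  · refine ⟨g, g + g, hgdepth, ?_, key g hg⟩
    simpa [two_smul] using hgdepth.smul (two_ne_zero (α := ℝ))
  · obtain ⟨h, hh⟩ := exists_minDepth (h12.trans h2.le)
    exact ⟨h, h + g, hh, hgdepth.add_of_lt hh.1 hlt, key h (NN_mono_s8 n h12 hh.1)⟩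

/-- For `m₁ < m₂` the deeper function may be chosen above or below the shallower one. -/
theorem exists_minDepth_max_of_lt {n m₁ m₂ mstar : ℕ} (hlt : m₁ < m₂) (h2 : m₂ ≤ Mn n)
    (hstar : mstar = m₁ ∨ mstar = m₂) :
    ∃ f₁ f₂ : (Fin n → ℝ) → ℝ, MinDepth n f₁ m₁ ∧ MinDepth n f₂ m₂ ∧
      MinDepth n (fun x => max (f₁ x) (f₂ x)) mstar := by
  obtain ⟨h, hh⟩ := exists_minDepth (hlt.le.trans h2)
  obtain ⟨m, rfl⟩ : ∃ m, m₂ = m + 1 := ⟨m₂ - 1, by omega⟩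
  obtain ⟨g, hg, hrelu⟩ := exists_relu_notMem_NN h2
  have hp := minDepth_relu hg hrelu
  rcases hstar with rfl | rfl
  · refine ⟨h, h + (-1 : ℝ) • fun x => max (g x) 0, hh,
      (hp.smul (by norm_num)).add_of_lt hh.1 hlt, ?_⟩
    convert hh using 1
    funext x
    simp
  · have hsum := hp.add_of_lt hh.1 hlt
    refine ⟨h, h + fun x => max (g x) 0, hh, hsum, ?_⟩
    convert hsum using 1
    funext x
    simp

theorem exists_minDepth_max_shallower {n m mstar : ℕ} (hlt : mstar < m) (hm : m ≤ Mn n) :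
    ∃ f₁ f₂ : (Fin n → ℝ) → ℝ, MinDepth n f₁ m ∧ MinDepth n f₂ m ∧
      MinDepth n (fun x => max (f₁ x) (f₂ x)) mstar := by
  obtain ⟨h, hh⟩ := exists_minDepth (hlt.le.trans hm)
  obtain ⟨m, rfl⟩ : ∃ k, m = k + 1 := ⟨m - 1, by omega⟩
  obtain ⟨g, hg, hrelu⟩ := exists_relu_notMem_NN hm
  have hp := (minDepth_relu hg hrelu).smul (c := -1) (by norm_num)
  have hq := hp.add_of_lt hg (Nat.lt_succ_self m)
  refine ⟨_, _, hp.add_of_lt hh.1 hlt, hq.add_of_lt hh.1 hlt, ?_⟩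
  convert hh using 1
  funext x
  simp only [Pi.add_apply, Pi.smul_apply, smul_eq_mul]
  rcases le_total (g x) 0 with hx | hx
  · rw [max_eq_right hx, max_eq_left (by linarith)]; ring
  · rw [max_eq_left hx, max_eq_right (by linarith)]; ring

/-- For `m₁ ≤ m₂ ≤ Mₙ` and `m*` with either `m₁ = m₂` and
`m* ≤ min (m₂ + 1) Mₙ`, or `m₁ ≠ m₂` and `m* ∈ {m₁, m₂, min (m₂ + 1) Mₙ}`, there exist CPWL
functions `f₁, f₂` of minimal depths `m₁, m₂` with `max (f₁, f₂)` of minimal depth `m*`. -/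
theorem statement8 (n m₁ m₂ mstar : ℕ) (h12 : m₁ ≤ m₂) (h2 : m₂ ≤ Mn n)
    (hstar : (m₁ = m₂ ∧ mstar ≤ min (m₂ + 1) (Mn n)) ∨
             (m₁ ≠ m₂ ∧ (mstar = m₁ ∨ mstar = m₂ ∨ mstar = min (m₂ + 1) (Mn n)))) :
    ∃ f₁ f₂ : (Fin n → ℝ) → ℝ, MinDepth n f₁ m₁ ∧ MinDepth n f₂ m₂ ∧
      MinDepth n (fun x => max (f₁ x) (f₂ x)) mstar := by
  rcases hstar with ⟨rfl, hle⟩ | ⟨hne, hstar⟩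
  · rcases lt_trichotomy mstar m₁ with hlt | rfl | hgt
    · exact exists_minDepth_max_shallower hlt h2
    · obtain ⟨f, hf⟩ := exists_minDepth h2
      exact ⟨f, f, hf, hf, by simpa using hf⟩
    · obtain rfl : mstar = m₁ + 1 := by omega
      exact exists_minDepth_max_succ le_rfl (by omega)
  · have hlt : m₁ < m₂ := lt_of_le_of_ne h12 hne
    rcases h2.eq_or_lt with heq | hltM
    · exact exists_minDepth_max_of_lt hlt h2 (by omega)
    · rcases hstar with h | h | h
      · exact exists_minDepth_max_of_lt hlt h2 (Or.inl h)
      · exact exists_minDepth_max_of_lt hlt h2 (Or.inr h)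
      · obtain rfl : mstar = m₂ + 1 := by omega
        exact exists_minDepth_max_succ h12 hltM
end
end

section
/- For any points a₁, …, a_p ∈ ℝⁿ, the polytope P = conv{a₁, …, a_p} belongs to Δₙ(⌈log₂ p⌉). -/
open Pointwise

noncomputable section

/-- A polytope in `ℝⁿ`: the convex hull of a nonempty finite set of points. -/
def IsPolytope (n : ℕ) (P : Set (Fin n → ℝ)) : Prop :=
  ∃ s : Finset (Fin n → ℝ), s.Nonempty ∧ P = convexHull ℝ ↑s

/-- `PolyDepth n m` is the set `Δₙ(m)` of neural network polytopes with `m` hidden layers: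
`Δₙ(0)` consists of the one-point polytopes, and `Δₙ(m)` consists of the Minkowski sums
`Σᵢ conv(Pᵢ ∪ Qᵢ)` with `Pᵢ, Qᵢ ∈ Δₙ(m-1)`. -/
def PolyDepth (n : ℕ) : ℕ → Set (Set (Fin n → ℝ))
  | 0 => {P | ∃ a, P = {a}}
  | m + 1 => {P | ∃ (k : ℕ) (Q R : Fin (k + 1) → Set (Fin n → ℝ)),
      (∀ i, Q i ∈ PolyDepth n m ∧ R i ∈ PolyDepth n m) ∧
      P = ∑ i, convexHull ℝ (Q i ∪ R i)}

/-- `P` has minimal depth `m`: `P ∈ Δₙ(m)` and either `m = 0` or `P ∉ Δₙ(m-1)`. -/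
def PolyMinDepth (n : ℕ) (P : Set (Fin n → ℝ)) (m : ℕ) : Prop :=
  P ∈ PolyDepth n m ∧ (m = 0 ∨ P ∉ PolyDepth n (m - 1))

/-- A nonempty face of `P`: either `P` itself or the set of maximizers over `P`
of a linear functional `x ↦ c·x`. -/
def IsFace (n : ℕ) (P F : Set (Fin n → ℝ)) : Prop :=
  F = P ∨ ∃ c : Fin n → ℝ, F = {x ∈ P | ∀ y ∈ P, ∑ i, c i * y i ≤ ∑ i, c i * x i}

/-- `P` is indecomposable: in every decomposition of `P` as a Minkowski sum of polytopes,
each summand is positively homothetic to `P` or a single point. -/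
def Indecomposable (n : ℕ) (P : Set (Fin n → ℝ)) : Prop :=
  ∀ (k : ℕ) (Q : Fin (k + 1) → Set (Fin n → ℝ)),
    (∀ i, IsPolytope n (Q i)) → P = ∑ i, Q i →
    ∀ i, (∃ (lam : ℝ) (w : Fin n → ℝ), 0 < lam ∧ Q i = (fun x => lam • x + w) '' P) ∨
      ∃ a, Q i = {a}

/-- The convex hull of the first `2 ^ m` terms of a sequence of points lies in `Δₙ(m)`. -/
theorem convexHull_image_Iio_two_pow_mem_polyDepth (n m : ℕ) (a : ℕ → Fin n → ℝ) :
    convexHull ℝ (a '' Set.Iio (2 ^ m)) ∈ PolyDepth n m := by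
  induction m generalizing a with
  | zero =>
    refine ⟨a 0, ?_⟩
    have h : Set.Iio (2 ^ 0) = ({0} : Set ℕ) := by ext; simp
    rw [h, Set.image_singleton, convexHull_singleton]
  | succ m ih =>
    refine ⟨0, fun _ => convexHull ℝ (a '' Set.Iio (2 ^ m)),
      fun _ => convexHull ℝ ((fun i => a (2 ^ m + i)) '' Set.Iio (2 ^ m)),
      fun _ => ⟨ih a, ih _⟩, ?_⟩
    rw [Fin.sum_univ_one, convexHull_convexHull_union_left, convexHull_convexHull_union_right]
    congr 1
    ext x
    simp only [Set.mem_union, Set.mem_image, Set.mem_Iio, pow_succ]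
    constructor
    · rintro ⟨i, hi, rfl⟩
      rcases lt_or_ge i (2 ^ m) with h | h
      · exact Or.inl ⟨i, h, rfl⟩
      · exact Or.inr ⟨i - 2 ^ m, by omega, by rw [Nat.add_sub_cancel' h]⟩
    · rintro (⟨i, hi, rfl⟩ | ⟨i, hi, rfl⟩)
      · exact ⟨i, by omega, rfl⟩
      · exact ⟨2 ^ m + i, by omega, rfl⟩

/-- For any points `a₁, …, a_p ∈ ℝⁿ`, `conv{a₁, …, a_p} ∈ Δₙ(⌈log₂ p⌉)`. -/
theorem statement13 (n p : ℕ) (hp : 0 < p) (a : Fin p → Fin n → ℝ) :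
    convexHull ℝ (Set.range a) ∈ PolyDepth n (Nat.clog 2 p) := by
  have hle : p ≤ 2 ^ Nat.clog 2 p := Nat.le_pow_clog one_lt_two p
  convert convexHull_image_Iio_two_pow_mem_polyDepth n (Nat.clog 2 p)
    (fun i => a ⟨i % p, Nat.mod_lt i hp⟩) using 2
  ext x
  constructor
  · rintro ⟨i, rfl⟩
    exact ⟨i, i.2.trans_le hle, congrArg a (Fin.ext (Nat.mod_eq_of_lt i.2))⟩
  · rintro ⟨i, -, rfl⟩
    exact Set.mem_range_self _
end
end

section
/- If P ∈ Δₙ(m), then every nonempty face F of P also belongs to Δₙ(m). -/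
open Pointwise

noncomputable section

section Maximizers

variable {E : Type*} [AddCommGroup E] [Module ℝ E]

/-- The set of maximizers over `P` of the linear functional `f`. -/
def maximizers (f : E →ₗ[ℝ] ℝ) (P : Set E) : Set E :=
  {x ∈ P | ∀ y ∈ P, f y ≤ f x}

theorem maximizers_sum {ι : Type*} [Fintype ι] (f : E →ₗ[ℝ] ℝ) (Q : ι → Set E) :
    maximizers f (∑ i, Q i) = ∑ i, maximizers f (Q i) := by
  classical
  ext x
  constructor
  · rintro ⟨hx, hmax⟩
    obtain ⟨g, hg, rfl⟩ := (Set.mem_fintype_sum _ _).1 hx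
    refine (Set.mem_fintype_sum _ _).2 ⟨g, fun i => ⟨hg i, fun y hy => ?_⟩, rfl⟩
    have h := hmax (∑ j, Function.update g i y j) ((Set.mem_fintype_sum _ _).2
      ⟨_, fun j => by
        by_cases hj : j = i
        · subst hj; simpa using hy
        · simpa [hj] using hg j, rfl⟩)
    rw [Finset.sum_update_of_mem (Finset.mem_univ i),
      ← Finset.add_sum_erase _ g (Finset.mem_univ i), Finset.sdiff_singleton_eq_erase] at h
    simp only [map_add] at h
    exact le_of_add_le_add_right h
  · intro hx
    obtain ⟨g, hg, rfl⟩ := (Set.mem_fintype_sum _ _).1 hx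
    refine ⟨(Set.mem_fintype_sum _ _).2 ⟨g, fun i => (hg i).1, rfl⟩, fun y hy => ?_⟩
    obtain ⟨h, hh, rfl⟩ := (Set.mem_fintype_sum _ _).1 hy
    simp only [map_sum]
    exact Finset.sum_le_sum fun i _ => (hg i).2 _ (hh i)

theorem maximizers_convexHull (f : E →ₗ[ℝ] ℝ) (S : Set E) :
    maximizers f (convexHull ℝ S) = convexHull ℝ (maximizers f S) := by
  ext x
  constructor
  · rintro ⟨hx, hmax⟩
    have hS : ∀ y ∈ S, f y ≤ f x := fun y hy => hmax y (subset_convexHull ℝ S hy)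
    have hconv : Convex ℝ {y | f y ≤ f x ∧ (f y = f x → y ∈ convexHull ℝ (maximizers f S))} := by
      rw [convex_iff_forall_pos]
      rintro y ⟨hy, hy'⟩ z ⟨hz, hz'⟩ a b ha hb hab
      have hsum : f x = a * f x + b * f x := by rw [← add_mul, hab, one_mul]
      have h₁ := mul_le_mul_of_nonneg_left hy ha.le
      have h₂ := mul_le_mul_of_nonneg_left hz hb.le
      simp only [Set.mem_ofPred_eq, map_add, map_smul, smul_eq_mul]
      refine ⟨by linarith, fun h => ?_⟩
      have hyx : f y = f x := mul_left_cancel₀ ha.ne' (by linarith)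
      have hzx : f z = f x := mul_left_cancel₀ hb.ne' (by linarith)
      exact convex_convexHull ℝ _ (hy' hyx) (hz' hzx) ha.le hb.le hab
    have hsub : S ⊆ {y | f y ≤ f x ∧ (f y = f x → y ∈ convexHull ℝ (maximizers f S))} :=
      fun y hy => ⟨hS y hy, fun h =>
        subset_convexHull ℝ _ ⟨hy, fun z hz => h ▸ hS z hz⟩⟩
    exact (convexHull_min hsub hconv hx).2 rfl
  · intro hx
    refine ⟨convexHull_mono (fun y hy => hy.1) hx, fun y hy => ?_⟩
    refine convexHull_min (t := {y | f y ≤ f x}) (fun z hz => ?_)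
      (convex_halfSpace_le f.isLinear _) hy
    exact convexHull_min (t := {w | f z ≤ f w}) (fun w hw => hw.2 z hz)
      (convex_halfSpace_ge f.isLinear _) hx

theorem maximizers_union_of_nonempty (f : E →ₗ[ℝ] ℝ) (Q R : Set E)
    (h : (maximizers f (Q ∪ R)).Nonempty) :
    ∃ A B, (A = maximizers f Q ∨ A = maximizers f R) ∧
      (B = maximizers f Q ∨ B = maximizers f R) ∧ A.Nonempty ∧ B.Nonempty ∧
      maximizers f (Q ∪ R) = A ∪ B := by
  have key : ∀ Q R : Set E, ∀ x ∈ Q, (∀ y ∈ Q ∪ R, f y ≤ f x) →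
      ∃ A B, (A = maximizers f Q ∨ A = maximizers f R) ∧
        (B = maximizers f Q ∨ B = maximizers f R) ∧ A.Nonempty ∧ B.Nonempty ∧
        maximizers f (Q ∪ R) = A ∪ B := by
    intro Q R x hxQ hx
    have hxm : x ∈ maximizers f Q := ⟨hxQ, fun y hy => hx y (Or.inl hy)⟩
    by_cases hR : ∃ z ∈ R, f z = f x
    · obtain ⟨z, hzR, hz⟩ := hR
      refine ⟨_, _, Or.inl rfl, Or.inr rfl, ⟨x, hxm⟩,
        ⟨z, hzR, fun y hy => hz ▸ hx y (Or.inr hy)⟩, ?_⟩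
      ext w
      constructor
      · rintro ⟨hw | hw, hmax⟩
        · exact Or.inl ⟨hw, fun y hy => hmax y (Or.inl hy)⟩
        · exact Or.inr ⟨hw, fun y hy => hmax y (Or.inr hy)⟩
      · rintro (hw | hw)
        · exact ⟨Or.inl hw.1, fun y hy => (hx y hy).trans (hw.2 x hxQ)⟩
        · exact ⟨Or.inr hw.1, fun y hy => (hx y hy).trans (hz ▸ hw.2 z hzR)⟩
    · refine ⟨_, _, Or.inl rfl, Or.inl rfl, ⟨x, hxm⟩, ⟨x, hxm⟩, ?_⟩
      rw [Set.union_self]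
      ext w
      constructor
      · rintro ⟨hw | hw, hmax⟩
        · exact ⟨hw, fun y hy => hmax y (Or.inl hy)⟩
        · exact absurd ⟨w, hw, (hx w (Or.inr hw)).antisymm (hmax x (Or.inl hxQ))⟩ hR
      · exact fun hw => ⟨Or.inl hw.1, fun y hy => (hx y hy).trans (hw.2 x hxQ)⟩
  obtain ⟨x, hxQ | hxR, hx⟩ := h
  · exact key Q R x hxQ hx
  · obtain ⟨A, B, hA, hB, h⟩ := key R Q x hxR (Set.union_comm Q R ▸ hx)
    exact ⟨A, B, hA.symm, hB.symm, Set.union_comm Q R ▸ h⟩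

end Maximizers

theorem maximizers_mem_polyDepth (n m : ℕ) (f : (Fin n → ℝ) →ₗ[ℝ] ℝ) (P : Set (Fin n → ℝ))
    (hP : P ∈ PolyDepth n m) (hne : (maximizers f P).Nonempty) :
    maximizers f P ∈ PolyDepth n m := by
  induction m generalizing P with
  | zero =>
    obtain ⟨a, rfl⟩ := hP
    exact ⟨a, hne.subset_singleton_iff.1 fun x hx => hx.1⟩
  | succ m ih =>
    obtain ⟨k, Q, R, hQR, rfl⟩ := hP
    simp only [maximizers_sum, maximizers_convexHull] at hne ⊢
    have hU : ∀ i, (maximizers f (Q i ∪ R i)).Nonempty := by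
      obtain ⟨x, hx⟩ := hne
      obtain ⟨g, hg, -⟩ := (Set.mem_fintype_sum _ _).1 hx
      exact fun i => convexHull_nonempty_iff.1 ⟨g i, hg i⟩
    choose A B hA hB hAne hBne hAB using
      fun i => maximizers_union_of_nonempty f (Q i) (R i) (hU i)
    have hmem : ∀ i C, (C = maximizers f (Q i) ∨ C = maximizers f (R i)) → C.Nonempty →
        C ∈ PolyDepth n m := by
      rintro i C (rfl | rfl) hC
      · exact ih _ (hQR i).1 hC
      · exact ih _ (hQR i).2 hC
    exact ⟨k, A, B, fun i => ⟨hmem i _ (hA i) (hAne i), hmem i _ (hB i) (hBne i)⟩, by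
      simp only [hAB]⟩

/-- If `P ∈ Δₙ(m)`, then every nonempty face `F` of `P` is in `Δₙ(m)`. -/
theorem statement15 (n m : ℕ) (P F : Set (Fin n → ℝ))
    (hP : P ∈ PolyDepth n m) (hF : IsFace n P F) (hne : F.Nonempty) :
    F ∈ PolyDepth n m := by
  obtain rfl | ⟨c, hF⟩ := hF
  · exact hP
  · have h : F = maximizers (∑ i, c i • LinearMap.proj i) P := by
      simp [hF, maximizers]
    exact h ▸ maximizers_mem_polyDepth n m _ P hP (h ▸ hne)
end
end

section
/- Let P be an indecomposable polytope in ℝⁿ with minimal depth m ≥ 1. Then there exist polytopes P₁, P₂ with minimal depths m₁, m₂ respectively such that P = conv(P₁ ∪ P₂) and m = max(m₁, m₂) + 1. -/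
open Pointwise

noncomputable section

theorem sum_singleton_set {ι E : Type*} [AddCommMonoid E] (s : Finset ι) (f : ι → E) :
    ∑ i ∈ s, ({f i} : Set E) = {∑ i ∈ s, f i} :=
  (map_sum (Set.singletonAddMonoidHom (α := E)) f s).symm

theorem image_smul_add_eq {n : ℕ} (a : ℝ) (w : Fin n → ℝ) (S : Set (Fin n → ℝ)) :
    (fun x => a • x + w) '' S = a • S + {w} := by
  rw [Set.add_singleton, ← Set.image_smul, Set.image_image]

namespace IsPolytope

variable {n : ℕ} {P Q : Set (Fin n → ℝ)}

theorem convex (h : IsPolytope n P) : Convex ℝ P := by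
  obtain ⟨s, -, rfl⟩ := h
  exact convex_convexHull ℝ _

theorem singleton (a : Fin n → ℝ) : IsPolytope n {a} :=
  ⟨{a}, by simp, by simp⟩

theorem add (hP : IsPolytope n P) (hQ : IsPolytope n Q) : IsPolytope n (P + Q) := by
  classical
  obtain ⟨s, hs, rfl⟩ := hP
  obtain ⟨t, ht, rfl⟩ := hQ
  exact ⟨s + t, hs.add ht, by rw [Finset.coe_add, convexHull_add]⟩

theorem sum {ι : Type*} (s : Finset ι) (f : ι → Set (Fin n → ℝ))
    (hf : ∀ i ∈ s, IsPolytope n (f i)) : IsPolytope n (∑ i ∈ s, f i) :=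
  Finset.sum_induction f (IsPolytope n) (fun _ _ => add) (singleton 0) hf

theorem convexHull_union (hP : IsPolytope n P) (hQ : IsPolytope n Q) :
    IsPolytope n (convexHull ℝ (P ∪ Q)) := by
  classical
  obtain ⟨s, hs, rfl⟩ := hP
  obtain ⟨t, -, rfl⟩ := hQ
  refine ⟨s ∪ t, hs.mono Finset.subset_union_left, ?_⟩
  rw [Finset.coe_union, convexHull_convexHull_union_left, convexHull_convexHull_union_right]

end IsPolytope

namespace PolyDepth

variable {n m : ℕ} {P Q : Set (Fin n → ℝ)}

theorem isPolytope (h : P ∈ PolyDepth n m) : IsPolytope n P := by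
  induction m generalizing P with
  | zero =>
    obtain ⟨a, rfl⟩ := h
    exact .singleton a
  | succ m ih =>
    obtain ⟨k, Q, R, hQR, rfl⟩ := h
    exact .sum _ _ fun i _ => (ih (hQR i).1).convexHull_union (ih (hQR i).2)

theorem convexHull_union (hP : P ∈ PolyDepth n m) (hQ : Q ∈ PolyDepth n m) :
    convexHull ℝ (P ∪ Q) ∈ PolyDepth n (m + 1) :=
  ⟨0, fun _ => P, fun _ => Q, fun _ => ⟨hP, hQ⟩, by simp⟩

theorem monotone (n : ℕ) : Monotone (PolyDepth n) :=
  monotone_nat_of_le_succ fun m P hP => by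
    have h := convexHull_union hP hP
    rwa [Set.union_self, (isPolytope hP).convex.convexHull_eq] at h

theorem smul_add_singleton (h : P ∈ PolyDepth n m) (a : ℝ) (w : Fin n → ℝ) :
    a • P + {w} ∈ PolyDepth n m := by
  induction m generalizing P w with
  | zero =>
    obtain ⟨b, rfl⟩ := h
    exact ⟨a • b + w, by simp⟩
  | succ m ih =>
    obtain ⟨k, Q, R, hQR, rfl⟩ := h
    let v : Fin (k + 1) → Fin n → ℝ := Pi.single 0 w
    have hv : ({w} : Set (Fin n → ℝ)) = ∑ i, {v i} := by
      simp [sum_singleton_set, v]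
    refine ⟨k, fun i => a • Q i + {v i}, fun i => a • R i + {v i},
      fun i => ⟨ih (hQR i).1 _, ih (hQR i).2 _⟩, ?_⟩
    rw [hv, Finset.smul_sum, ← Finset.sum_add_distrib]
    refine Finset.sum_congr rfl fun i _ => ?_
    rw [← Set.union_add, ← Set.smul_set_union, convexHull_add, convexHull_smul,
      convexHull_singleton]

theorem exists_minDepth_le (h : P ∈ PolyDepth n m) : ∃ k ≤ m, PolyMinDepth n P k := by
  classical
  have hex : ∃ k, P ∈ PolyDepth n k := ⟨m, h⟩
  refine ⟨Nat.find hex, Nat.find_min' hex h, Nat.find_spec hex, ?_⟩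
  rcases Nat.eq_zero_or_pos (Nat.find hex) with h0 | h0
  · exact .inl h0
  · exact .inr (Nat.find_min hex (Nat.sub_one_lt h0.ne'))

end PolyDepth

theorem Indecomposable.exists_eq_convexHull_union {n m : ℕ} {P : Set (Fin n → ℝ)}
    (hind : Indecomposable n P) (hP : P ∈ PolyDepth n (m + 1)) (hP' : P ∉ PolyDepth n m) :
    ∃ Q ∈ PolyDepth n m, ∃ R ∈ PolyDepth n m, P = convexHull ℝ (Q ∪ R) := by
  obtain ⟨k, Q, R, hQR, hsum⟩ := hP
  have hsplit := hind k _ (fun i => (PolyDepth.isPolytope (hQR i).1).convexHull_union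
    (PolyDepth.isPolytope (hQR i).2)) hsum
  by_cases hpt : ∀ i, ∃ a, convexHull ℝ (Q i ∪ R i) = {a}
  · choose a ha using hpt
    refine absurd (PolyDepth.monotone n (Nat.zero_le m) ⟨∑ i, a i, ?_⟩) hP'
    rw [hsum, ← sum_singleton_set]
    exact Finset.sum_congr rfl fun i _ => ha i
  · push Not at hpt
    obtain ⟨i, hi⟩ := hpt
    obtain ⟨c, w, hc, hcw⟩ := (hsplit i).resolve_right fun ⟨a, ha⟩ => hi a ha
    refine ⟨_, PolyDepth.smul_add_singleton (hQR i).1 c⁻¹ (-(c⁻¹ • w)),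
      _, PolyDepth.smul_add_singleton (hQR i).2 c⁻¹ (-(c⁻¹ • w)), ?_⟩
    rw [← Set.union_add, ← Set.smul_set_union, convexHull_add, convexHull_smul,
      convexHull_singleton, hcw, image_smul_add_eq, smul_add, inv_smul_smul₀ hc.ne',
      Set.smul_set_singleton, add_assoc, Set.singleton_add_singleton, add_neg_cancel,
      Set.singleton_zero, add_zero]

/-- If `P` is an indecomposable polytope with minimal depth `m ≥ 1`, then there
are polytopes `P₁, P₂` of minimal depths `m₁, m₂` with `P = conv(P₁ ∪ P₂)` and
`m = max m₁ m₂ + 1`. -/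
theorem statement16 (n m : ℕ) (P : Set (Fin n → ℝ))
    (hpoly : IsPolytope n P) (hind : Indecomposable n P)
    (hmin : PolyMinDepth n P m) (hm : 1 ≤ m) :
    ∃ (P₁ P₂ : Set (Fin n → ℝ)) (m₁ m₂ : ℕ),
      IsPolytope n P₁ ∧ IsPolytope n P₂ ∧
      PolyMinDepth n P₁ m₁ ∧ PolyMinDepth n P₂ m₂ ∧
      P = convexHull ℝ (P₁ ∪ P₂) ∧ m = max m₁ m₂ + 1 := by
  obtain ⟨m, rfl⟩ := Nat.exists_eq_add_of_le' hm
  obtain ⟨hP, hP'⟩ := hmin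
  replace hP' : P ∉ PolyDepth n m := hP'.resolve_left (Nat.succ_ne_zero m)
  obtain ⟨Q, hQ, R, hR, hPQR⟩ := hind.exists_eq_convexHull_union hP hP'
  obtain ⟨m₁, h₁, hm₁⟩ := PolyDepth.exists_minDepth_le hQ
  obtain ⟨m₂, h₂, hm₂⟩ := PolyDepth.exists_minDepth_le hR
  refine ⟨Q, R, m₁, m₂, PolyDepth.isPolytope hQ, PolyDepth.isPolytope hR, hm₁, hm₂, hPQR, ?_⟩
  by_contra hne
  have hlt : max m₁ m₂ + 1 ≤ m := by omega
  refine hP' (PolyDepth.monotone n hlt ?_)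
  rw [hPQR]
  exact PolyDepth.convexHull_union (PolyDepth.monotone n (le_max_left m₁ m₂) hm₁.1)
    (PolyDepth.monotone n (le_max_right m₁ m₂) hm₂.1)
end
end

section
/- Every polygon (polytope in ℝ²) belongs to Δ₂(2). -/
open Pointwise

noncomputable section

/-- The functional `x ↦ t x₀ + x₁`. -/
def upperForm (t : ℝ) : (Fin 2 → ℝ) →ₗ[ℝ] ℝ :=
  t • LinearMap.proj 0 + LinearMap.proj 1

/-- The functional `x ↦ t x₀ - x₁`. -/
def lowerForm (t : ℝ) : (Fin 2 → ℝ) →ₗ[ℝ] ℝ :=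
  t • LinearMap.proj 0 - LinearMap.proj 1

@[simp] lemma upperForm_apply (t : ℝ) (x : Fin 2 → ℝ) : upperForm t x = t * x 0 + x 1 := by
  simp [upperForm]

@[simp] lemma lowerForm_apply (t : ℝ) (x : Fin 2 → ℝ) : lowerForm t x = t * x 0 - x 1 := by
  simp [lowerForm]

/-- `v` lists the values of the support function of `K` in the directions `(t, 1)` and `(t, -1)`. -/
def HasSupport (K : Set (Fin 2 → ℝ)) (v : (ℝ → ℝ) × (ℝ → ℝ)) : Prop :=
  ∀ t, IsLUB (upperForm t '' K) (v.1 t) ∧ IsLUB (lowerForm t '' K) (v.2 t)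

/-- `v` is the support function of the convex hull of some four points. -/
def IsQuadSupport (v : (ℝ → ℝ) × (ℝ → ℝ)) : Prop :=
  ∃ p : Fin 4 → Fin 2 → ℝ, ∀ t,
    ((∀ i, upperForm t (p i) ≤ v.1 t) ∧ ∃ i, v.1 t ≤ upperForm t (p i)) ∧
    ((∀ i, lowerForm t (p i) ≤ v.2 t) ∧ ∃ i, v.2 t ≤ lowerForm t (p i))

/-- Finite sums of support functions of convex hulls of four points. -/
def quadSupportSums : AddSubmonoid ((ℝ → ℝ) × (ℝ → ℝ)) :=
  AddSubmonoid.closure {v | IsQuadSupport v}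

lemma IsQuadSupport.mem {v : (ℝ → ℝ) × (ℝ → ℝ)} (h : IsQuadSupport v) : v ∈ quadSupportSums :=
  AddSubmonoid.subset_closure h

lemma IsQuadSupport.smul {v : (ℝ → ℝ) × (ℝ → ℝ)} (h : IsQuadSupport v) {r : ℝ} (hr : 0 ≤ r) :
    IsQuadSupport (r • v) := by
  obtain ⟨p, hp⟩ := h
  refine ⟨fun i => r • p i, fun t => ?_⟩
  obtain ⟨⟨h1, i, hi⟩, h2, j, hj⟩ := hp t
  simp only [map_smul, smul_eq_mul, Prod.smul_fst, Prod.smul_snd, Pi.smul_apply]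
  exact ⟨⟨fun k => mul_le_mul_of_nonneg_left (h1 k) hr, i, mul_le_mul_of_nonneg_left hi hr⟩,
    fun k => mul_le_mul_of_nonneg_left (h2 k) hr, j, mul_le_mul_of_nonneg_left hj hr⟩

lemma smul_mem_quadSupportSums {v : (ℝ → ℝ) × (ℝ → ℝ)} (hv : v ∈ quadSupportSums) {r : ℝ}
    (hr : 0 ≤ r) : r • v ∈ quadSupportSums := by
  induction hv using AddSubmonoid.closure_induction with
  | mem x hx => exact (IsQuadSupport.smul hx hr).mem
  | zero => simp [zero_mem]
  | add x y _ _ hx hy => rw [smul_add]; exact add_mem hx hy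

lemma isLUB_image_convexHull {E : Type*} [AddCommGroup E] [Module ℝ E] (f : E →ₗ[ℝ] ℝ)
    {S : Set E} {y : ℝ} (h : ∀ x ∈ S, f x ≤ y) (h' : ∃ x ∈ S, y ≤ f x) :
    IsLUB (f '' convexHull ℝ S) y := by
  obtain ⟨x, hx, hyx⟩ := h'
  refine ⟨?_, fun z hz => hyx.trans (hz ⟨x, subset_convexHull ℝ S hx, rfl⟩)⟩
  rintro _ ⟨w, hw, rfl⟩
  exact convexHull_min (t := {w | f w ≤ y}) h (convex_halfSpace_le f.isLinear y) hw

lemma HasSupport.add {K L : Set (Fin 2 → ℝ)} {v w : (ℝ → ℝ) × (ℝ → ℝ)}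
    (hv : HasSupport K v) (hw : HasSupport L w) : HasSupport (K + L) (v + w) := by
  intro t
  rw [Set.image_add, Set.image_add]
  exact ⟨(hv t).1.add (hw t).1, (hv t).2.add (hw t).2⟩

/-- Compact convex sets in the plane are determined by their support functions in all
non-horizontal directions. -/
lemma HasSupport.subset {K L : Set (Fin 2 → ℝ)} {v : (ℝ → ℝ) × (ℝ → ℝ)}
    (hK : HasSupport K v) (hL : HasSupport L v) (hc : IsCompact L) (hconv : Convex ℝ L) :
    K ⊆ L := by
  intro x hx
  by_contra hxL
  obtain ⟨f, u, hu, hux⟩ := geometric_hahn_banach_closed_point hconv hc.isClosed hxL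
  have hf : ∀ y : Fin 2 → ℝ, f y = f (Pi.single 0 1) * y 0 + f (Pi.single 1 1) * y 1 := by
    intro y
    conv_lhs => rw [pi_eq_sum_univ' y]
    simp [Fin.sum_univ_two, mul_comm]
  set a := f (Pi.single 0 1)
  set b := f (Pi.single 1 1)
  obtain ⟨q, hq, w, hw, hwx⟩ : ∃ q : ℝ, q ≠ 0 ∧ ∃ w, (∀ y ∈ L, a * y 0 + q * y 1 ≤ w) ∧
      w < a * x 0 + q * x 1 := by
    by_cases hb : b = 0
    · obtain ⟨M, hM⟩ := (hc.image (continuous_apply (1 : Fin 2))).bddAbove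
      have hM' : ∀ y ∈ L, y 1 ≤ M := fun y hy => hM ⟨y, hy, rfl⟩
      have hd : 0 < f x - u := sub_pos.2 hux
      have hden : 0 < 1 + |M - x 1| := by positivity
      refine ⟨(f x - u) / (1 + |M - x 1|), by positivity,
        u + (f x - u) / (1 + |M - x 1|) * M, fun y hy => ?_, ?_⟩
      · have h1 := (hu y hy).le
        rw [hf y, hb] at h1
        have h2 := mul_le_mul_of_nonneg_left (hM' y hy) (by positivity :
          0 ≤ (f x - u) / (1 + |M - x 1|))
        linarith
      · have h1 : (f x - u) / (1 + |M - x 1|) * (M - x 1) < f x - u := by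
          rw [div_mul_eq_mul_div, div_lt_iff₀ hden]
          exact mul_lt_mul_of_pos_left (by linarith [le_abs_self (M - x 1)]) hd
        have h2 := hf x
        rw [hb] at h2
        linarith
    · exact ⟨b, hb, u, fun y hy => (hf y ▸ hu y hy).le, hf x ▸ hux⟩
  rcases hq.lt_or_gt with hneg | hpos
  · have h4 : ∀ y : Fin 2 → ℝ, lowerForm (a / -q) y = (a * y 0 + q * y 1) / -q := by
      intro y
      rw [lowerForm_apply]
      field_simp
      ring
    have h1 : v.2 (a / -q) ≤ w / -q := (hL (a / -q)).2.2 <| by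
      rintro _ ⟨y, hy, rfl⟩
      rw [h4]
      exact div_le_div_of_nonneg_right (hw y hy) (neg_pos.2 hneg).le
    have h2 := (hK (a / -q)).2.1 ⟨x, hx, rfl⟩
    have h3 := div_lt_div_of_pos_right hwx (neg_pos.2 hneg)
    rw [h4] at h2
    linarith
  · have h4 : ∀ y : Fin 2 → ℝ, upperForm (a / q) y = (a * y 0 + q * y 1) / q := by
      intro y
      rw [upperForm_apply]
      field_simp
    have h1 : v.1 (a / q) ≤ w / q := (hL (a / q)).1.2 <| by
      rintro _ ⟨y, hy, rfl⟩
      rw [h4]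
      exact div_le_div_of_nonneg_right (hw y hy) hpos.le
    have h2 := (hK (a / q)).1.1 ⟨x, hx, rfl⟩
    have h3 := div_lt_div_of_pos_right hwx hpos
    rw [h4] at h2
    linarith

lemma add_mem_polyDepth {n m : ℕ} {P Q : Set (Fin n → ℝ)} (hP : P ∈ PolyDepth n (m + 1))
    (hQ : Q ∈ PolyDepth n (m + 1)) : P + Q ∈ PolyDepth n (m + 1) := by
  obtain ⟨k, A, B, hAB, rfl⟩ := hP
  obtain ⟨l, A', B', hAB', rfl⟩ := hQ
  refine ⟨k + 1 + l, Fin.append (n := l + 1) A A', Fin.append (n := l + 1) B B', fun i => ?_, ?_⟩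
  · refine Fin.addCases (m := k + 1) (n := l + 1) (fun i => ?_) (fun i => ?_) i
    · rw [Fin.append_left, Fin.append_left]; exact hAB i
    · rw [Fin.append_right, Fin.append_right]; exact hAB' i
  · refine Eq.trans ?_ (Fin.sum_univ_add (a := k + 1) (b := l + 1) _).symm
    simp only [Fin.append_left, Fin.append_right]

lemma convexHull_union_mem_polyDepth {n m : ℕ} {P Q : Set (Fin n → ℝ)} (hP : P ∈ PolyDepth n m)
    (hQ : Q ∈ PolyDepth n m) : convexHull ℝ (P ∪ Q) ∈ PolyDepth n (m + 1) :=
  ⟨0, fun _ => P, fun _ => Q, fun _ => ⟨hP, hQ⟩, by simp⟩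

lemma convexHull_range_four_mem_polyDepth {n : ℕ} (p : Fin 4 → Fin n → ℝ) :
    convexHull ℝ (Set.range p) ∈ PolyDepth n 2 := by
  have hseg : ∀ a b : Fin n → ℝ, convexHull ℝ ({a} ∪ {b}) ∈ PolyDepth n 1 := fun a b =>
    convexHull_union_mem_polyDepth (m := 0) ⟨a, rfl⟩ ⟨b, rfl⟩
  have := convexHull_union_mem_polyDepth (hseg (p 0) (p 1)) (hseg (p 2) (p 3))
  rw [convexHull_convexHull_union_left, convexHull_convexHull_union_right] at this
  convert this using 2
  ext x
  simp [Fin.exists_fin_succ, eq_comm]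
  tauto

lemma exists_hasSupport {v : (ℝ → ℝ) × (ℝ → ℝ)} (hv : v ∈ quadSupportSums) :
    ∃ K ∈ PolyDepth 2 2, IsCompact K ∧ Convex ℝ K ∧ HasSupport K v := by
  have hquad : ∀ w, IsQuadSupport w →
      ∃ K ∈ PolyDepth 2 2, IsCompact K ∧ Convex ℝ K ∧ HasSupport K w := by
    rintro w ⟨p, hp⟩
    refine ⟨_, convexHull_range_four_mem_polyDepth p,
      (Set.finite_range p).isCompact_convexHull ℝ, convex_convexHull ℝ _, fun t => ?_⟩
    exact ⟨isLUB_image_convexHull _ (Set.forall_mem_range.2 (hp t).1.1)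
        (Set.exists_range_iff.2 (hp t).1.2),
      isLUB_image_convexHull _ (Set.forall_mem_range.2 (hp t).2.1)
        (Set.exists_range_iff.2 (hp t).2.2)⟩
  induction hv using AddSubmonoid.closure_induction with
  | mem w hw => exact hquad w hw
  | zero => exact hquad 0 ⟨0, by simp⟩
  | add x y _ _ hx hy =>
    obtain ⟨K, hK, hKc, hKx, hKs⟩ := hx
    obtain ⟨L, hL, hLc, hLx, hLs⟩ := hy
    exact ⟨K + L, add_mem_polyDepth hK hL, hKc.add hLc, hKx.add hLx, hKs.add hLs⟩

lemma IsQuadSupport.of_coords {F G : ℝ → ℝ} (x y : Fin 4 → ℝ)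
    (hF : ∀ t i, t * x i + y i ≤ F t) (hF' : ∀ t, ∃ i, F t ≤ t * x i + y i)
    (hG : ∀ t i, t * x i - y i ≤ G t) (hG' : ∀ t, ∃ i, G t ≤ t * x i - y i) :
    IsQuadSupport (F, G) :=
  ⟨fun i => ![x i, y i], fun t => by
    simpa [-tsub_le_iff_right] using And.intro ⟨hF t, hF' t⟩ ⟨hG t, hG' t⟩⟩

lemma isQuadSupport_point (a b : ℝ) :
    IsQuadSupport (fun t => t * a + b, fun t => t * a - b) :=
  .of_coords (fun _ => a) (fun _ => b) (fun _ _ => le_rfl) (fun _ => ⟨0, le_rfl⟩)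
    (fun _ _ => le_rfl) (fun _ => ⟨0, le_rfl⟩)

lemma isQuadSupport_verticalSegment : IsQuadSupport (fun _ => 1, fun _ => 0) := by
  refine .of_coords 0 ![0, 1, 0, 0] ?_ (fun t => ⟨1, by simp⟩) ?_ (fun t => ⟨0, by simp⟩) <;>
  · intro t i
    fin_cases i <;> simp

lemma isQuadSupport_of_add_nonpos {a b : ℝ} (h : a + b ≤ 0) :
    IsQuadSupport (fun t => max (t - a) 0, fun t => max (t - b) 0) := by
  refine .of_coords ![0, 1, 1, 0] ![0, -a, b, 0] ?_ (fun t => ?_) ?_ (fun t => ?_)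
  · intro t i
    fin_cases i <;> simp <;> grind
  · rcases le_total t a with h | h
    · exact ⟨0, by simpa using h⟩
    · exact ⟨1, by simp [h, sub_eq_add_neg]⟩
  · intro t i
    fin_cases i <;> simp <;> grind
  · rcases le_total t b with h | h
    · exact ⟨0, by simpa using h⟩
    · exact ⟨2, by simp [h]⟩

lemma isQuadSupport_of_add_nonneg {a b : ℝ} (h : 0 ≤ a + b) :
    IsQuadSupport (fun t => max (t - a) 0 + (a + b), fun t => max (t - b) 0) := by
  refine .of_coords ![0, 0, 1, 0] ![a + b, 0, b, 0] ?_ (fun t => ?_) ?_ (fun t => ?_)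
  · intro t i
    fin_cases i <;> simp <;> grind
  · rcases le_total t a with h | h
    · exact ⟨0, by simpa using h⟩
    · exact ⟨2, by simp [h]; linarith⟩
  · intro t i
    fin_cases i <;> simp <;> grind
  · rcases le_total t b with h | h
    · exact ⟨1, by simpa using h⟩
    · exact ⟨2, by simp [h]⟩

lemma mul_le_mul_max_add_mul_max {p q r x y z : ℝ} (hp : 0 ≤ p) (hq : 0 ≤ q) (hr : 0 ≤ r)
    (hrpq : r ≤ p + q) (hz : (p + q) * z ≤ p * x + q * y) :
    r * z ≤ p * max x 0 + q * max y 0 := by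
  have hx := mul_le_mul_of_nonneg_left (le_max_left x 0) hp
  have hy := mul_le_mul_of_nonneg_left (le_max_left y 0) hq
  rcases le_total z 0 with h | h
  · have : 0 ≤ p * max x 0 + q * max y 0 := by positivity
    linarith [mul_nonpos_of_nonneg_of_nonpos hr h]
  · linarith [mul_le_mul_of_nonneg_right hrpq h]

lemma isQuadSupport_of_le {p q a b a' b' : ℝ} (hp : 0 ≤ p) (hq : 0 ≤ q) (hab : a ≤ b)
    (h : p * (a + a') + q * (b + b') = 0) :
    IsQuadSupport (fun t => p * max (t - a) 0 + q * max (t - b) 0,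
      fun t => p * max (t - a') 0 + q * max (t - b') 0) := by
  have hmax : ∀ {r : ℝ}, 0 ≤ r → ∀ x, 0 ≤ r * max x 0 ∧ r * x ≤ r * max x 0 := fun hr x =>
    ⟨by positivity, mul_le_mul_of_nonneg_left (le_max_left x 0) hr⟩
  have hU : ∀ t, p * (t + a) ≤ p * max (t - a') 0 + q * max (t - b') 0 := fun t =>
    mul_le_mul_max_add_mul_max hp hq hp (by linarith)
      (by linarith [mul_le_mul_of_nonneg_left hab hq])
  have hupper : ∀ t, ∃ i : Fin 3, p * max (t - a) 0 + q * max (t - b) 0 ≤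
      t * ![0, p + q, p] i + ![0, -p * a - q * b, -p * a] i := by
    intro t
    rcases le_total t a with h1 | h1
    · exact ⟨0, by simp [h1, h1.trans hab]⟩
    rcases le_total t b with h2 | h2
    · exact ⟨2, by simp [h1, h2]; linarith⟩
    · exact ⟨1, by simp [h1, h2]; linarith⟩
  rcases le_total a' b' with hab' | hab'
  · have hL : ∀ t, p * (t + a') ≤ p * max (t - a) 0 + q * max (t - b) 0 := fun t =>
      mul_le_mul_max_add_mul_max hp hq hp (by linarith)
        (by linarith [mul_le_mul_of_nonneg_left hab' hq])
    refine .of_coords ![0, p + q, p, p] ![0, -p * a - q * b, -p * a, p * a'] ?_ (fun t => ?_) ?_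
      (fun t => ?_)
    · intro t i
      have := hmax hp (t - a)
      have := hmax hq (t - b)
      have := hL t
      fin_cases i <;> simp <;> linarith
    · obtain ⟨i, hi⟩ := hupper t
      exact ⟨i.castSucc, by fin_cases i <;> simpa using hi⟩
    · intro t i
      have := hmax hp (t - a')
      have := hmax hq (t - b')
      have := hU t
      fin_cases i <;> simp <;> linarith
    · rcases le_total t a' with h1 | h1
      · exact ⟨0, by simp [h1, h1.trans hab']⟩
      rcases le_total t b' with h2 | h2
      · exact ⟨3, by simp [h1, h2]; linarith⟩
      · exact ⟨1, by simp [h1, h2]; linarith⟩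
  · have hL : ∀ t, q * (t + b') ≤ p * max (t - a) 0 + q * max (t - b) 0 := fun t =>
      mul_le_mul_max_add_mul_max hp hq hq (by linarith)
        (by linarith [mul_le_mul_of_nonneg_left hab' hp])
    refine .of_coords ![0, p + q, p, q] ![0, -p * a - q * b, -p * a, q * b'] ?_ (fun t => ?_) ?_
      (fun t => ?_)
    · intro t i
      have := hmax hp (t - a)
      have := hmax hq (t - b)
      have := hL t
      fin_cases i <;> simp <;> linarith
    · obtain ⟨i, hi⟩ := hupper t
      exact ⟨i.castSucc, by fin_cases i <;> simpa using hi⟩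
    · intro t i
      have := hmax hp (t - a')
      have := hmax hq (t - b')
      have := hU t
      fin_cases i <;> simp <;> linarith
    · rcases le_total t b' with h1 | h1
      · exact ⟨0, by simp [h1, h1.trans hab']⟩
      rcases le_total t a' with h2 | h2
      · exact ⟨3, by simp [h1, h2]; linarith⟩
      · exact ⟨1, by simp [h1, h2]; linarith⟩

lemma isQuadSupport_of_balanced {p q a b a' b' : ℝ} (hp : 0 ≤ p) (hq : 0 ≤ q)
    (h : p * (a + a') + q * (b + b') = 0) :
    IsQuadSupport (fun t => p * max (t - a) 0 + q * max (t - b) 0,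
      fun t => p * max (t - a') 0 + q * max (t - b') 0) := by
  rcases le_total a b with hab | hab
  · exact isQuadSupport_of_le hp hq hab h
  · simpa only [add_comm] using
      isQuadSupport_of_le (a' := b') (b' := a') hq hp hab (by linarith)

/-- Vectors `v i` with defects `s i` can be combined inside a cone `C` as soon as the total defect
is nonpositive, provided that the individual vectors of nonpositive defect and the balanced
combinations of two vectors of opposite defects lie in `C`. -/
lemma sum_smul_mem_of_balanced {V ι : Type*} [AddCommGroup V] [Module ℝ V] [Fintype ι]
    (C : AddSubmonoid V) (hC : ∀ v ∈ C, ∀ r : ℝ, 0 ≤ r → r • v ∈ C) (v : ι → V) (s c : ι → ℝ)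
    (hc : ∀ i, 0 ≤ c i) (hnonpos : ∀ i, s i ≤ 0 → v i ∈ C)
    (hpair : ∀ i j, 0 < s i → s j < 0 → (-s j) • v i + s i • v j ∈ C)
    (hsum : ∑ i, c i * s i ≤ 0) : ∑ i, c i • v i ∈ C := by
  classical
  set P := Finset.univ.filter fun i => 0 < s i with hP
  set N := Finset.univ.filter fun i => ¬ 0 < s i with hN
  have hPs : ∀ i ∈ P, 0 < s i := by simp [hP]
  have hNs : ∀ i ∈ N, s i ≤ 0 := by simp [hN]
  set A := ∑ i ∈ P, c i * s i with hA
  set B := ∑ i ∈ N, c i * -s i with hB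
  have hAB : A ≤ B := by
    rw [← Finset.sum_filter_add_sum_filter_not Finset.univ fun i => 0 < s i] at hsum
    simp only [mul_neg, Finset.sum_neg_distrib] at hB
    linarith
  have hA0 : 0 ≤ A := Finset.sum_nonneg fun i hi => mul_nonneg (hc i) (hPs i hi).le
  have hNmem : ∑ i ∈ N, c i • v i ∈ C :=
    sum_mem fun i hi => hC _ (hnonpos i (hNs i hi)) _ (hc i)
  rw [← Finset.sum_filter_add_sum_filter_not Finset.univ fun i => 0 < s i]
  rcases (hA0.trans hAB).eq_or_lt with hB0 | hB0
  · have hA0' : A = 0 := le_antisymm (hAB.trans hB0.ge) hA0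
    have hz := (Finset.sum_eq_zero_iff_of_nonneg fun i hi =>
      mul_nonneg (hc i) (hPs i hi).le).1 hA0'
    rw [Finset.sum_eq_zero fun i hi => ?_, zero_add]
    · exact hNmem
    · rw [(mul_eq_zero.1 (hz i hi)).resolve_right (hPs i hi).ne', zero_smul]
  · have hmix : ∑ i ∈ P, ∑ j ∈ N, (c i * c j) • ((-s j) • v i + s i • v j) ∈ C := by
      refine sum_mem fun i hi => sum_mem fun j hj =>
        hC _ ?_ _ (mul_nonneg (hc i) (hc j))
      rcases (hNs j hj).eq_or_lt with h0 | h0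
      · rw [h0, neg_zero, zero_smul, zero_add]
        exact hC _ (hnonpos j h0.le) _ (hPs i hi).le
      · exact hpair i j (hPs i hi) h0
    have hmix_eq : ∑ i ∈ P, ∑ j ∈ N, (c i * c j) • ((-s j) • v i + s i • v j) =
        B • ∑ i ∈ P, c i • v i + A • ∑ j ∈ N, c j • v j := by
      simp only [smul_add, Finset.sum_add_distrib]
      congr 1
      · rw [Finset.smul_sum]
        refine Finset.sum_congr rfl fun i _ => ?_
        rw [hB, smul_smul, Finset.sum_mul, Finset.sum_smul]
        refine Finset.sum_congr rfl fun j _ => ?_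
        rw [smul_smul]
        congr 1
        ring
      · rw [Finset.sum_comm, Finset.smul_sum]
        refine Finset.sum_congr rfl fun j _ => ?_
        rw [hA, smul_smul, Finset.sum_mul, Finset.sum_smul]
        refine Finset.sum_congr rfl fun i _ => ?_
        rw [smul_smul]
        congr 1
        ring
    have key : ∑ i ∈ P, c i • v i + ∑ i ∈ N, c i • v i =
        B⁻¹ • ∑ i ∈ P, ∑ j ∈ N, (c i * c j) • ((-s j) • v i + s i • v j) +
          (1 - A / B) • ∑ i ∈ N, c i • v i := by
      rw [hmix_eq, smul_add, smul_smul, smul_smul, inv_mul_cancel₀ hB0.ne', one_smul, add_assoc,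
        ← add_smul]
      congr 1
      rw [show B⁻¹ * A + (1 - A / B) = 1 by ring, one_smul]
    rw [key]
    exact add_mem (hC _ hmix _ (inv_nonneg.2 hB0.le))
      (hC _ hNmem _ (sub_nonneg.2 ((div_le_one hB0).2 hAB)))

/-- The convex piecewise linear function with leftmost piece `t * β + α` whose slope increases by
`c i` at `τ i`. -/
def hingeSum {ι : Type} [Fintype ι] (c τ : ι → ℝ) (α β t : ℝ) : ℝ :=
  t * β + α + ∑ i, c i * max (t - τ i) 0

lemma hingeSum_of_forall_le {ι : Type} [Fintype ι] {c τ : ι → ℝ} {α β t : ℝ}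
    (ht : ∀ i, t ≤ τ i) : hingeSum c τ α β t = t * β + α := by
  simp [hingeSum, ht]

lemma hingeSum_of_forall_ge {ι : Type} [Fintype ι] {c τ : ι → ℝ} {α β t : ℝ}
    (ht : ∀ i, τ i ≤ t) :
    hingeSum c τ α β t = t * (β + ∑ i, c i) + (α - ∑ i, c i * τ i) := by
  have : ∑ i, c i * max (t - τ i) 0 = t * ∑ i, c i - ∑ i, c i * τ i := by
    rw [Finset.mul_sum, ← Finset.sum_sub_distrib]
    refine Finset.sum_congr rfl fun i _ => ?_
    rw [max_eq_left (sub_nonneg.2 (ht i))]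
    ring
  rw [hingeSum, this]
  ring

lemma hingeSum_sub_le {ι : Type} [Fintype ι] {c τ : ι → ℝ} (hc : ∀ i, 0 ≤ c i) (α β : ℝ)
    {t u : ℝ} (htu : t ≤ u) :
    hingeSum c τ α β u - hingeSum c τ α β t ≤ (u - t) * (β + ∑ i, c i) := by
  have : ∑ i, c i * max (u - τ i) 0 ≤ ∑ i, c i * max (t - τ i) 0 + (u - t) * ∑ i, c i := by
    rw [Finset.mul_sum, ← Finset.sum_add_distrib]
    refine Finset.sum_le_sum fun i _ => ?_
    have h : max (u - τ i) 0 ≤ max (t - τ i) 0 + (u - t) :=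
      max_le (by linarith [le_max_left (t - τ i) 0]) (by linarith [le_max_right (t - τ i) 0])
    linarith [mul_le_mul_of_nonneg_left h (hc i)]
  simp only [hingeSum]
  linarith

lemma continuous_hingeSum {ι : Type} [Fintype ι] (c τ : ι → ℝ) (α β : ℝ) :
    Continuous (hingeSum c τ α β) := by
  unfold hingeSum
  fun_prop

/-- Truncating a hinge sum at `T` and continuing it with slope `a`. -/
lemma exists_hingeSum_truncate {ι : Type} [Fintype ι] {c τ : ι → ℝ} (hc : ∀ i, 0 ≤ c i)
    {α β a b T : ℝ} (ha : β + ∑ i, c i ≤ a) (hT : hingeSum c τ α β T = T * a + b) :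
    ∃ c' τ' : Option ι → ℝ, (∀ i, 0 ≤ c' i) ∧ β + ∑ i, c' i = a ∧ α - ∑ i, c' i * τ' i = b ∧
      (∀ t ≤ T, hingeSum c' τ' α β t = hingeSum c τ α β t) ∧
      ∀ t, T ≤ t → hingeSum c' τ' α β t = t * a + b := by
  classical
  set d : ι → ℝ := fun i => if τ i ≤ T then c i else 0 with hd
  have hd0 : ∀ i, 0 ≤ d i := fun i => by simp only [hd]; split_ifs <;> simp [hc]
  have hdc : ∑ i, d i ≤ ∑ i, c i :=
    Finset.sum_le_sum fun i _ => by simp only [hd]; split_ifs <;> simp [hc]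
  have hleft : ∀ t ≤ T, ∑ i, d i * max (t - τ i) 0 = ∑ i, c i * max (t - τ i) 0 := by
    intro t ht
    refine Finset.sum_congr rfl fun i _ => ?_
    by_cases h : τ i ≤ T
    · simp [hd, h]
    · rw [max_eq_right (by linarith)]
      simp
  have hright : ∀ t, T ≤ t → ∑ i, d i * max (t - τ i) 0 = t * ∑ i, d i - ∑ i, d i * τ i := by
    intro t ht
    rw [Finset.mul_sum, ← Finset.sum_sub_distrib]
    refine Finset.sum_congr rfl fun i _ => ?_
    by_cases h : τ i ≤ T
    · rw [max_eq_left (by linarith)]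
      ring
    · simp [hd, h]
  have hb : T * β + α + (T * ∑ i, d i - ∑ i, d i * τ i) = T * a + b := by
    rw [← hT, hingeSum, ← hleft T le_rfl, hright T le_rfl]
  refine ⟨fun o => o.elim (a - β - ∑ i, d i) d, fun o => o.elim T τ, ?_, ?_, ?_, ?_, ?_⟩
  · rintro (_ | i)
    · simp only [Option.elim]
      linarith
    · exact hd0 i
  · simp [Fintype.sum_option]
  · simp only [Fintype.sum_option, Option.elim]
    linarith
  · intro t ht
    simp only [hingeSum, Fintype.sum_option, Option.elim]
    rw [hleft t ht, max_eq_right (by linarith)]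
    ring
  · intro t ht
    simp only [hingeSum, Fintype.sum_option, Option.elim]
    rw [hright t ht, max_eq_left (by linarith)]
    linarith

/-- A maximum of finitely many affine functions is a hinge sum. -/
lemma exists_hingeSum_eq_max (s : Finset (ℝ × ℝ)) (hs : s.Nonempty) :
    ∃ (ι : Type) (_ : Fintype ι) (c τ : ι → ℝ) (α β : ℝ), (∀ i, 0 ≤ c i) ∧ (β, α) ∈ s ∧
      (β + ∑ i, c i, α - ∑ i, c i * τ i) ∈ s ∧
      ∀ t, (∀ p ∈ s, t * p.1 + p.2 ≤ hingeSum c τ α β t) ∧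
        ∃ p ∈ s, hingeSum c τ α β t ≤ t * p.1 + p.2 := by
  classical
  induction s using Finset.induction_on_max_value (fun p : ℝ × ℝ => p.1) with
  | empty => exact absurd hs Finset.not_nonempty_empty
  | insert l s _ hmax ih =>
    obtain ⟨a, b⟩ := l
    rcases s.eq_empty_or_nonempty with rfl | hne
    · exact ⟨Empty, inferInstance, 0, 0, b, a, by simp, by simp, by simp, by simp [hingeSum]⟩
    obtain ⟨ι, _, c, τ, α, β, hc, hleft, hright, hval⟩ := ih hne
    have ha : β + ∑ i, c i ≤ a := hmax _ hright
    by_cases h1 : ∀ t, t * a + b ≤ hingeSum c τ α β t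
    · refine ⟨ι, inferInstance, c, τ, α, β, hc, Finset.mem_insert_of_mem hleft,
        Finset.mem_insert_of_mem hright, fun t => ⟨?_, ?_⟩⟩
      · intro p hp
        rcases Finset.mem_insert.1 hp with rfl | hp
        · exact h1 t
        · exact (hval t).1 p hp
      · obtain ⟨p, hp, h⟩ := (hval t).2
        exact ⟨p, Finset.mem_insert_of_mem hp, h⟩
    by_cases h2 : ∀ t, hingeSum c τ α β t ≤ t * a + b
    · refine ⟨Empty, inferInstance, 0, 0, b, a, by simp, by simp, by simp, fun t => ⟨?_, ?_⟩⟩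
      · intro p hp
        simp only [hingeSum, Finset.univ_eq_empty, Finset.sum_empty, add_zero]
        rcases Finset.mem_insert.1 hp with rfl | hp
        · exact le_rfl
        · exact ((hval t).1 p hp).trans (h2 t)
      · exact ⟨(a, b), Finset.mem_insert_self _ _, by simp [hingeSum]⟩
    push Not at h1 h2
    obtain ⟨t₁, ht₁⟩ := h1
    obtain ⟨t₂, ht₂⟩ := h2
    obtain ⟨T, hT⟩ : ∃ T, hingeSum c τ α β T = T * a + b :=
      mem_range_of_exists_le_of_exists_ge (f := fun t => hingeSum c τ α β t - (t * a + b))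
        ((continuous_hingeSum c τ α β).sub (by fun_prop)) ⟨t₁, by linarith⟩
        ⟨t₂, by linarith⟩ |>.imp fun T h => sub_eq_zero.1 h
    have hmono : ∀ {t u : ℝ}, t ≤ u →
        hingeSum c τ α β u - hingeSum c τ α β t ≤ (u - t) * a := fun htu =>
      (hingeSum_sub_le hc α β htu).trans (mul_le_mul_of_nonneg_left ha (sub_nonneg.2 htu))
    obtain ⟨c', τ', hc', hslope, hint, hbefore, hafter⟩ := exists_hingeSum_truncate hc ha hT
    refine ⟨Option ι, inferInstance, c', τ', α, β, hc', Finset.mem_insert_of_mem hleft, ?_,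
      fun t => ?_⟩
    · rw [hslope, hint]
      exact Finset.mem_insert_self _ _
    rcases le_total t T with ht | ht
    · rw [hbefore t ht]
      refine ⟨fun p hp => ?_, ?_⟩
      · rcases Finset.mem_insert.1 hp with rfl | hp
        · have := hmono ht
          simp only
          linarith
        · exact (hval t).1 p hp
      · obtain ⟨p, hp, h⟩ := (hval t).2
        exact ⟨p, Finset.mem_insert_of_mem hp, h⟩
    · rw [hafter t ht]
      refine ⟨fun p hp => ?_, (a, b), Finset.mem_insert_self _ _, le_rfl⟩
      rcases Finset.mem_insert.1 hp with rfl | hp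
      · exact le_rfl
      · have := hmono ht
        have := (hval t).1 p hp
        linarith

lemma le_of_forall_le_affine {a b a' b' T : ℝ} (h : ∀ t, T ≤ t → t * a + b ≤ t * a' + b') :
    a ≤ a' ∧ (a = a' → b ≤ b') := by
  refine ⟨?_, fun he => by have := h T le_rfl; rw [he] at this; linarith⟩
  by_contra! hlt
  have hpos : 0 < a - a' := sub_pos.2 hlt
  have h1 := h (max T ((b' - b + 1) / (a - a'))) (le_max_left _ _)
  have h2 := mul_le_mul_of_nonneg_right (le_max_right T ((b' - b + 1) / (a - a'))) hpos.le
  rw [div_mul_cancel₀ _ hpos.ne'] at h2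
  linarith

lemma affine_le_hingeSum {ι : Type} [Fintype ι] {c τ : ι → ℝ} {α β a b : ℝ}
    (h : ∀ t, t * a + b ≤ hingeSum c τ α β t) :
    (β ≤ a ∧ (a = β → b ≤ α)) ∧
      (a ≤ β + ∑ i, c i ∧ (a = β + ∑ i, c i → b ≤ α - ∑ i, c i * τ i)) := by
  have hτ : ∀ i, |τ i| ≤ ∑ j, |τ j| := fun i =>
    Finset.single_le_sum (f := fun j => |τ j|) (fun j _ => abs_nonneg _) (Finset.mem_univ i)
  constructor
  · have := le_of_forall_le_affine (a := -a) (b := b) (a' := -β) (b' := α) (T := ∑ j, |τ j|)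
      fun t ht => by
        have h1 := h (-t)
        rw [hingeSum_of_forall_le fun i => by linarith [hτ i, neg_abs_le (τ i)]] at h1
        linarith
    exact ⟨neg_le_neg_iff.1 this.1, fun he => this.2 (by rw [he])⟩
  · refine le_of_forall_le_affine (T := ∑ j, |τ j|) fun t ht => ?_
    rw [← hingeSum_of_forall_ge fun i => by linarith [hτ i, le_abs_self (τ i)]]
    exact h t

lemma hingeSum_pair_mem_quadSupportSums {ι κ : Type} [Fintype ι] [Fintype κ] {c τ : ι → ℝ}
    {d σ : κ → ℝ} {α α' β : ℝ} (hc : ∀ i, 0 ≤ c i) (hd : ∀ j, 0 ≤ d j)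
    (hcd : ∑ i, c i = ∑ j, d j) (hα : 0 ≤ α + α')
    (hright : ∑ i, c i * τ i + ∑ j, d j * σ j ≤ α + α') :
    (hingeSum c τ α β, hingeSum d σ α' β) ∈ quadSupportSums := by
  set M := ∑ i, c i with hM
  have hM0 : 0 ≤ M := Finset.sum_nonneg fun i _ => hc i
  have hcM : ∀ i, c i * M / M = c i := by
    intro i
    rcases hM0.eq_or_lt with h | h
    · rw [(Finset.sum_eq_zero_iff_of_nonneg fun i _ => hc i).1 h.symm i (Finset.mem_univ i)]
      simp
    · exact mul_div_cancel_right₀ _ h.ne'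
  have hdM : ∀ j, M * d j / M = d j := by
    intro j
    rcases hM0.eq_or_lt with h | h
    · rw [(Finset.sum_eq_zero_iff_of_nonneg fun j _ => hd j).1 (hcd ▸ h.symm) j
        (Finset.mem_univ j)]
      simp
    · exact mul_div_cancel_left₀ _ h.ne'
  have hfst : ∀ g : ι → ℝ, ∑ i, ∑ j, c i * d j / M * g i = ∑ i, c i * g i := by
    intro g
    refine Finset.sum_congr rfl fun i _ => ?_
    rw [← Finset.sum_mul, ← Finset.sum_div, ← Finset.mul_sum, ← hcd, hcM]
  have hsnd : ∀ g : κ → ℝ, ∑ i, ∑ j, c i * d j / M * g j = ∑ j, d j * g j := by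
    intro g
    rw [Finset.sum_comm]
    refine Finset.sum_congr rfl fun j _ => ?_
    rw [← Finset.sum_mul, ← Finset.sum_div, ← Finset.sum_mul, ← hM, hdM]
  let v : Option (ι × κ) → (ℝ → ℝ) × (ℝ → ℝ) := fun o =>
    o.elim (fun _ => 1, fun _ => 0) fun m =>
      (fun t => max (t - τ m.1) 0, fun t => max (t - σ m.2) 0)
  let s : Option (ι × κ) → ℝ := fun o => o.elim (-1) fun m => τ m.1 + σ m.2
  let w : Option (ι × κ) → ℝ := fun o => o.elim (α + α') fun m => c m.1 * d m.2 / M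
  have hmem : ∑ o, w o • v o ∈ quadSupportSums := by
    refine sum_smul_mem_of_balanced quadSupportSums
      (fun v hv r hr => smul_mem_quadSupportSums hv hr) v s w ?_ ?_ ?_ ?_
    · rintro (_ | ⟨i, j⟩)
      · exact hα
      · exact div_nonneg (mul_nonneg (hc i) (hd j)) hM0
    · rintro (_ | ⟨i, j⟩) h
      · exact isQuadSupport_verticalSegment.mem
      · exact (isQuadSupport_of_add_nonpos h).mem
    · rintro (_ | ⟨i, j⟩) (_ | ⟨k, l⟩) hpos hneg
      · simp only [s, Option.elim] at hpos
        linarith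
      · simp only [s, Option.elim] at hpos
        linarith
      · convert (isQuadSupport_of_add_nonneg (le_of_lt hpos)).mem using 1
        ext t <;> simp [v, s]
      · convert (isQuadSupport_of_balanced (p := -(τ k + σ l)) (q := τ i + σ j) (a := τ i)
          (b := τ k) (a' := σ j) (b' := σ l) (neg_nonneg.2 (le_of_lt hneg)) (le_of_lt hpos)
          (by ring)).mem using 1
        ext t <;> simp [v, s]
    · simp only [Fintype.sum_option, Fintype.sum_prod_type, w, s, Option.elim, mul_add,
        Finset.sum_add_distrib]
      rw [hfst, hsnd]
      linarith
  convert add_mem (isQuadSupport_point β (-α')).mem hmem using 1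
  ext t
  · simp only [Fintype.sum_option, Fintype.sum_prod_type, w, v, Option.elim, hingeSum,
      Prod.fst_add, Prod.fst_sum, Prod.smul_fst, Pi.add_apply, Finset.sum_apply, Pi.smul_apply,
      smul_eq_mul]
    rw [hfst fun i => max (t - τ i) 0]
    ring
  · simp only [Fintype.sum_option, Fintype.sum_prod_type, w, v, Option.elim, hingeSum,
      Prod.snd_add, Prod.snd_sum, Prod.smul_snd, Pi.add_apply, Finset.sum_apply, Pi.smul_apply,
      smul_eq_mul]
    rw [hsnd fun j => max (t - σ j) 0]
    ring

/-- Every polygon (polytope in ℝ²) belongs to `Δ₂(2)`. -/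
theorem statement17 (P : Set (Fin 2 → ℝ)) (hP : IsPolytope 2 P) :
    P ∈ PolyDepth 2 2 := by
  classical
  obtain ⟨s, hs, rfl⟩ := hP
  obtain ⟨ι, _, c, τ, α, β, hc, hleft, hright, hval⟩ :=
    exists_hingeSum_eq_max (s.image fun x => (x 0, x 1)) (hs.image _)
  obtain ⟨κ, _, d, σ, α', β', hd, hleft', hright', hval'⟩ :=
    exists_hingeSum_eq_max (s.image fun x => (x 0, -x 1)) (hs.image _)
  simp only [Finset.forall_mem_image, Finset.exists_mem_image] at hval hval'
  have hle := fun x hx => affine_le_hingeSum fun t => (hval t).1 (x := x) hx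
  have hle' := fun x hx => affine_le_hingeSum fun t => (hval' t).1 (x := x) hx
  simp only [Finset.mem_image, Prod.mk.injEq] at hleft hright hleft' hright'
  obtain ⟨x, hx, hx0, hx1⟩ := hleft
  obtain ⟨y, hy, hy0, hy1⟩ := hright
  obtain ⟨x', hx', hx0', hx1'⟩ := hleft'
  obtain ⟨y', hy', hy0', hy1'⟩ := hright'
  obtain rfl : β = β' := le_antisymm (hx0' ▸ (hle x' hx').1.1) (hx0 ▸ (hle' x hx).1.1)
  have hcd : ∑ i, c i = ∑ j, d j := by
    have h1 := (hle y' hy').2.1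
    have h2 := (hle' y hy).2.1
    linarith
  have hα := (hle x' hx').1.2 hx0'
  have hα' := (hle y' hy').2.2 (by rw [hy0', hcd])
  obtain ⟨K, hK, hKc, hKx, hKs⟩ := exists_hasSupport
    (hingeSum_pair_mem_quadSupportSums (α := α) (α' := α') (β := β) (τ := τ) (σ := σ) hc hd hcd
      (by linarith) (by linarith))
  have hsupp : HasSupport (convexHull ℝ ↑s) (hingeSum c τ α β, hingeSum d σ α' β) := fun t =>
    ⟨isLUB_image_convexHull _ (by simpa using (hval t).1) (by simpa using (hval t).2),
      isLUB_image_convexHull _ (by simpa [sub_eq_add_neg] using (hval' t).1)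
        (by simpa [sub_eq_add_neg] using (hval' t).2)⟩
  have hEq : convexHull ℝ (s : Set (Fin 2 → ℝ)) = K :=
    (hsupp.subset hKs hKc hKx).antisymm
      (hKs.subset hsupp (s.finite_toSet.isCompact_convexHull ℝ) (convex_convexHull ℝ _))
  rw [hEq]
  exact hK
end
end
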